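/- For integers p > q > 0, there exists a lattice segment L such that the Minkowski sum 𝒴^{p,q} + L is a toric diagram admitting a lattice maximal Minkowski decomposition if and only if q = 1 or p − q is odd. -/

import Mathlib

open Set Pointwise

noncomputable section

/-- We work in the plane `ℝ × ℝ`. -/
abbrev V : Type := ℝ × ℝ

/-- The embedding of the lattice `ℤ × ℤ` into the plane. -/
def toR (p : ℤ × ℤ) : V := ((p.1 : ℝ), (p.2 : ℝ))

/-- The set of lattice points of the plane. -/
def latticePoints : Set V := Set.range toR

/-- A lattice polytope: the convex hull of a nonempty finite set of lattice points. -/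
def IsLatticePolytope (P : Set V) : Prop :=
  ∃ S : Finset (ℤ × ℤ), S.Nonempty ∧ P = convexHull ℝ (toR '' ↑S)

/-- A toric diagram: a two-dimensional lattice polytope such that every lattice point on its
topological boundary is an extreme point. -/
def IsToricDiagram (P : Set V) : Prop :=
  IsLatticePolytope P ∧ (interior P).Nonempty ∧
    ∀ x ∈ frontier P, x ∈ latticePoints → x ∈ P.extremePoints ℝ

/-- A lattice segment: the convex hull of two distinct lattice points. -/
def IsLatticeSegment (L : Set V) : Prop :=
  ∃ a b : ℤ × ℤ, a ≠ b ∧ L = segment ℝ (toR a) (toR b)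

/-- A lattice triangle: the convex hull of three affinely independent lattice points. -/
def IsLatticeTriangle (T : Set V) : Prop :=
  ∃ a b c : ℤ × ℤ, AffineIndependent ℝ ![toR a, toR b, toR c] ∧
    T = convexHull ℝ {toR a, toR b, toR c}

/-- `E` is an edge of `P`: a maximal (nondegenerate) line segment contained in the
topological boundary of `P`. -/
def IsEdge (P E : Set V) : Prop :=
  (∃ a b : V, a ≠ b ∧ E = segment ℝ a b) ∧ E ⊆ frontier P ∧
    ∀ F : Set V, (∃ a b : V, F = segment ℝ a b) → F ⊆ frontier P → E ⊆ F → F = E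

/-- `v` is an edge vector of `P` (the difference of the endpoints of some edge of `P`). -/
def IsEdgeVector (P : Set V) (v : V) : Prop :=
  ∃ a b : V, a ≠ b ∧ IsEdge P (segment ℝ a b) ∧ v = b - a

/-- Two plane vectors are parallel when their cross product vanishes. -/
def Par (v w : V) : Prop := v.1 * w.2 = v.2 * w.1

/-- `P` admits a lattice maximal Minkowski decomposition: `P` is a Minkowski sum of at
least two lattice polytopes, each of which is a lattice segment or a lattice triangle. -/
def HasLatticeMaximalDecomposition (P : Set V) : Prop :=
  ∃ (m : ℕ) (Ps : Fin (m + 1) → Set V), 1 ≤ m ∧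
    P = ∑ k, Ps k ∧ ∀ k, IsLatticeSegment (Ps k) ∨ IsLatticeTriangle (Ps k)

/-- A convex polytope: the convex hull of a nonempty finite set of points. -/
def IsConvexPolytope (A : Set V) : Prop :=
  ∃ S : Finset V, S.Nonempty ∧ A = convexHull ℝ (↑S : Set V)

/-- `A` is a homothet `λ • P + t` (`λ > 0`) of `P`. -/
def IsHomothet (A P : Set V) : Prop :=
  ∃ (l : ℝ) (t : V), 0 < l ∧ A = (fun x => l • x + t) '' P

/-- A (nondegenerate) line segment. -/
def IsSegmentSet (A : Set V) : Prop := ∃ a b : V, a ≠ b ∧ A = segment ℝ a b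

/-- A triangle: the convex hull of three affinely independent points. -/
def IsTriangleSet (A : Set V) : Prop :=
  ∃ a b c : V, AffineIndependent ℝ ![a, b, c] ∧ A = convexHull ℝ {a, b, c}

/-- A convex polytope is Minkowski-indecomposable if in every Minkowski decomposition
into two convex polytopes, one of the summands is a point or a homothet of the polytope. -/
def MinkowskiIndecomposable (Q : Set V) : Prop :=
  ∀ A B : Set V, IsConvexPolytope A → IsConvexPolytope B → Q = A + B →
    (∃ x, A = {x}) ∨ IsHomothet A Q ∨ (∃ x, B = {x}) ∨ IsHomothet B Q

/-- A parallelogram: a quadrilateral whose vertices `v₁ v₂ v₃ v₄` in cyclic order satisfy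
`v₁ + v₃ = v₂ + v₄`. -/
def IsParallelogram (P : Set V) : Prop :=
  ∃ w : Fin 4 → V, Function.Injective w ∧ P.extremePoints ℝ = Set.range w ∧
    w 0 + w 2 = w 1 + w 3

/-- The Gauntlett–Martelli–Sparks–Waldram toric diagram `𝒴^{p,q}`. -/
def GMSW (p q : ℤ) : Set V :=
  convexHull ℝ (toR '' ({(0, 0), (1, 0), (p, p), (p - q - 1, p - q)} : Set (ℤ × ℤ)))

/-- Cross product of lattice vectors. -/
def crossZ (u w : ℤ × ℤ) : ℤ := u.1 * w.2 - u.2 * w.1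

/-- The face of `K` on which the linear functional `φ` is maximal. -/
def face (φ : V →ₗ[ℝ] ℝ) (K : Set V) : Set V := {x ∈ K | ∀ y ∈ K, φ y ≤ φ x}

theorem face_add (φ : V →ₗ[ℝ] ℝ) (K K' : Set V) : face φ (K + K') = face φ K + face φ K' := by
  ext x
  constructor
  · rintro ⟨⟨a, ha, b, hb, rfl⟩, h⟩
    refine ⟨a, ⟨ha, fun y hy => ?_⟩, b, ⟨hb, fun y hy => ?_⟩, rfl⟩
    · have := h _ (add_mem_add hy hb)
      simp only [map_add] at this
      linarith
    · have := h _ (add_mem_add ha hy)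
      simp only [map_add] at this
      linarith
  · rintro ⟨a, ⟨ha, ha'⟩, b, ⟨hb, hb'⟩, rfl⟩
    refine ⟨add_mem_add ha hb, ?_⟩
    rintro _ ⟨y, hy, z, hz, rfl⟩
    simp only [map_add]
    linarith [ha' y hy, hb' z hz]

theorem face_sum {ι : Type*} (φ : V →ₗ[ℝ] ℝ) (s : Finset ι) (K : ι → Set V) :
    face φ (∑ i ∈ s, K i) = ∑ i ∈ s, face φ (K i) := by
  classical
  induction s using Finset.induction_on with
  | empty => ext x; simp +contextual [face]
  | insert a s ha ih => rw [Finset.sum_insert ha, Finset.sum_insert ha, face_add, ih]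

theorem subsingleton_sum {ι : Type*} (s : Finset ι) (K : ι → Set V)
    (h : ∀ i ∈ s, (K i).Subsingleton) : (∑ i ∈ s, K i).Subsingleton := by
  classical
  induction s using Finset.induction_on with
  | empty => exact Set.subsingleton_singleton
  | insert a s ha ih =>
    rw [Finset.sum_insert ha]
    rintro _ ⟨x, hx, y, hy, rfl⟩ _ ⟨x', hx', y', hy', rfl⟩
    rw [h a (by simp) hx hx', ih (fun i hi => h i (by simp [hi])) hy hy']

theorem mem_face_convexHull (φ : V →ₗ[ℝ] ℝ) {S : Set V} {x : V} (hx : x ∈ S)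
    (h : ∀ y ∈ S, φ y ≤ φ x) : x ∈ face φ (convexHull ℝ S) := by
  refine ⟨subset_convexHull ℝ S hx, fun y hy => ?_⟩
  have hc : Convex ℝ {y | φ y ≤ φ x} := convex_halfSpace_le φ.isLinear _
  exact convexHull_min (t := {y | φ y ≤ φ x}) h hc hy

theorem face_convexHull_subset (φ : V →ₗ[ℝ] ℝ) (S : Set V) :
    face φ (convexHull ℝ S) ⊆ convexHull ℝ (face φ S) := by
  rintro x ⟨hx, hmax⟩
  have hS : ∀ s ∈ S, φ s ≤ φ x := fun s hs => hmax s (subset_convexHull ℝ S hs)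
  have hc : Convex ℝ {y | φ y < φ x ∨ φ y = φ x ∧ y ∈ convexHull ℝ (face φ S)} := by
    rintro y hy z hz a b ha hb hab
    have hle : ∀ w ∈ {y | φ y < φ x ∨ φ y = φ x ∧ y ∈ convexHull ℝ (face φ S)}, φ w ≤ φ x := by
      rintro w (h | h)
      exacts [h.le, h.1.le]
    rcases ha.eq_or_lt with rfl | ha
    · obtain rfl : b = 1 := by linarith
      simpa using hz
    rcases hb.eq_or_lt with rfl | hb
    · obtain rfl : a = 1 := by linarith
      simpa using hy
    have hy' := hle y hy
    have hz' := hle z hz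
    have key : φ (a • y + b • z) = φ x - (a * (φ x - φ y) + b * (φ x - φ z)) := by
      simp only [map_add, map_smul, smul_eq_mul]
      linear_combination φ x * hab
    rcases hy with hy | ⟨hy, hy2⟩
    · left
      rw [key]
      nlinarith [mul_pos ha (sub_pos.2 hy), mul_nonneg hb.le (sub_nonneg.2 hz')]
    rcases hz with hz | ⟨hz, hz2⟩
    · left
      rw [key]
      nlinarith [mul_pos hb (sub_pos.2 hz), mul_nonneg ha.le (sub_nonneg.2 hy')]
    · right
      exact ⟨by rw [key, hy, hz]; ring, (convex_convexHull ℝ _) hy2 hz2 ha.le hb.le hab⟩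
  have hsub : S ⊆ {y | φ y < φ x ∨ φ y = φ x ∧ y ∈ convexHull ℝ (face φ S)} := by
    intro s hs
    rcases (hS s hs).lt_or_eq with h | h
    · exact Or.inl h
    · exact Or.inr ⟨h, subset_convexHull ℝ _ ⟨hs, fun t ht => h ▸ hS t ht⟩⟩
  rcases convexHull_min hsub hc hx with h | h
  · exact absurd h (lt_irrefl _)
  · exact h.2

/-- The convex hull of a set of lattice points. -/
def latticeHull (S : Set (ℤ × ℤ)) : Set V := convexHull ℝ (toR '' S)

/-- The linear functional `x ↦ v · x`. -/
def dot (v : ℤ × ℤ) : V →ₗ[ℝ] ℝ :=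
  (v.1 : ℝ) • LinearMap.fst ℝ ℝ ℝ + (v.2 : ℝ) • LinearMap.snd ℝ ℝ ℝ

theorem dot_apply (v : ℤ × ℤ) (x : V) : dot v x = v.1 * x.1 + v.2 * x.2 := rfl

theorem dot_toR (v s : ℤ × ℤ) : dot v (toR s) = ((v.1 * s.1 + v.2 * s.2 : ℤ) : ℝ) := by
  simp [dot_apply, toR]

theorem toR_injective : Function.Injective toR := by
  rintro ⟨a, b⟩ ⟨c, d⟩ h
  simpa [toR] using h

theorem toR_add (a b : ℤ × ℤ) : toR (a + b) = toR a + toR b := by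
  simp [toR]

theorem toR_sum {ι : Type*} (s : Finset ι) (z : ι → ℤ × ℤ) :
    toR (∑ i ∈ s, z i) = ∑ i ∈ s, toR (z i) :=
  map_sum (AddMonoidHom.mk' toR toR_add) z s

theorem latticeHull_add (S T : Set (ℤ × ℤ)) :
    latticeHull (S + T) = latticeHull S + latticeHull T := by
  rw [latticeHull, latticeHull, latticeHull, ← convexHull_add]
  congr 1
  exact Set.image_image2_distrib toR_add

/-- The elements of `S` maximizing the integral functional `v`. -/
def latticeFace (v : ℤ × ℤ) (S : Set (ℤ × ℤ)) : Set (ℤ × ℤ) :=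
  {s ∈ S | ∀ t ∈ S, v.1 * t.1 + v.2 * t.2 ≤ v.1 * s.1 + v.2 * s.2}

theorem face_image_toR (v : ℤ × ℤ) (S : Set (ℤ × ℤ)) :
    face (dot v) (toR '' S) = toR '' latticeFace v S := by
  ext x
  constructor
  · rintro ⟨⟨s, hs, rfl⟩, h⟩
    refine ⟨s, ⟨hs, fun t ht => ?_⟩, rfl⟩
    have := h _ (mem_image_of_mem toR ht)
    rw [dot_toR, dot_toR] at this
    exact_mod_cast this
  · rintro ⟨s, ⟨hs, h⟩, rfl⟩
    refine ⟨mem_image_of_mem toR hs, ?_⟩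
    rintro _ ⟨t, ht, rfl⟩
    rw [dot_toR, dot_toR]
    exact_mod_cast h t ht

theorem toR_mem_face {v : ℤ × ℤ} {S : Set (ℤ × ℤ)} {s : ℤ × ℤ} (hs : s ∈ latticeFace v S) :
    toR s ∈ face (dot v) (latticeHull S) := by
  have : toR s ∈ face (dot v) (toR '' S) := face_image_toR v S ▸ mem_image_of_mem toR hs
  exact mem_face_convexHull _ this.1 this.2

theorem subsingleton_face_latticeHull {v : ℤ × ℤ} {S : Set (ℤ × ℤ)}
    (h : (latticeFace v S).Subsingleton) : (face (dot v) (latticeHull S)).Subsingleton := by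
  have h1 := face_convexHull_subset (dot v) (toR '' S)
  have h2 : (toR '' latticeFace v S).Subsingleton := h.image toR
  rw [face_image_toR, h2.convex.convexHull_eq] at h1
  exact h2.anti h1

theorem latticeFace_nonempty (v : ℤ × ℤ) {S : Set (ℤ × ℤ)} (hf : S.Finite) (hS : S.Nonempty) :
    (latticeFace v S).Nonempty := by
  obtain ⟨a, ha, h⟩ := S.exists_max_image (fun s => v.1 * s.1 + v.2 * s.2) hf hS
  exact ⟨a, ha, h⟩

theorem dot_self_pos {v : ℤ × ℤ} (hv : v ≠ 0) : 0 < dot v (toR v) := by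
  rw [dot_toR]
  have : v.1 ≠ 0 ∨ v.2 ≠ 0 := by
    by_contra! h
    exact hv (Prod.ext h.1 h.2)
  rcases this with h | h <;>
  · have := mul_self_pos.2 h
    norm_cast
    nlinarith [mul_self_nonneg v.1, mul_self_nonneg v.2]

theorem mem_frontier_of_mem_face {P : Set V} {v : ℤ × ℤ} (hv : v ≠ 0) {x : V}
    (hx : x ∈ face (dot v) P) : x ∈ frontier P := by
  refine ⟨subset_closure hx.1, fun hi => ?_⟩
  have hc : ContinuousAt (fun t : ℝ => x + t • toR v) 0 := by fun_prop
  have hmem : ∀ᶠ t : ℝ in nhds 0, x + t • toR v ∈ P :=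
    hc (by simpa using mem_interior_iff_mem_nhds.1 hi)
  obtain ⟨t, ht, ht0⟩ :=
    ((hmem.filter_mono nhdsWithin_le_nhds).and (self_mem_nhdsWithin (s := Ioi (0 : ℝ)))).exists
  have := hx.2 _ ht
  simp only [map_add, map_smul, smul_eq_mul] at this
  linarith [mul_pos ht0 (dot_self_pos hv)]

theorem collinear_of_dot_eq {v : ℤ × ℤ} (hv : v ≠ 0) {x y z : V} (hy : dot v y = dot v x)
    (hz : dot v z = dot v x) : Collinear ℝ {x, y, z} := by
  have h0 := (dot_self_pos hv).ne'
  rw [dot_toR] at h0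
  have h1 : (v.1 : ℝ) ^ 2 + (v.2 : ℝ) ^ 2 ≠ 0 := by
    rw [sq, sq]
    exact_mod_cast h0
  rw [collinear_iff_of_mem (p₀ := x) (by simp)]
  refine ⟨(-(v.2 : ℝ), (v.1 : ℝ)), ?_⟩
  have key : ∀ p : V, dot v p = dot v x → ∃ r : ℝ, p = r • (-(v.2 : ℝ), (v.1 : ℝ)) +ᵥ x := by
    intro p hp
    rw [dot_apply, dot_apply] at hp
    refine ⟨(-v.2 * (p.1 - x.1) + v.1 * (p.2 - x.2)) / ((v.1 : ℝ) ^ 2 + (v.2 : ℝ) ^ 2),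
      Prod.ext ?_ ?_⟩
    · simp only [vadd_eq_add, Prod.fst_add, Prod.smul_fst, smul_eq_mul]
      field_simp
      linear_combination (v.1 : ℝ) * hp
    · simp only [vadd_eq_add, Prod.snd_add, Prod.smul_snd, smul_eq_mul]
      field_simp
      linear_combination (v.2 : ℝ) * hp
  rintro p (rfl | rfl | rfl)
  exacts [key _ rfl, key _ hy, key _ hz]

/-- A proper face of a toric diagram has at most two lattice points. -/
theorem IsToricDiagram.eq_or_eq_or_eq {P : Set V} (hP : IsToricDiagram P) {v : ℤ × ℤ}
    (hv : v ≠ 0) {x y z : ℤ × ℤ} (hx : toR x ∈ face (dot v) P) (hy : toR y ∈ face (dot v) P)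
    (hz : toR z ∈ face (dot v) P) : x = y ∨ y = z ∨ x = z := by
  have main : ∀ {x y z : ℤ × ℤ}, toR x ∈ face (dot v) P → toR y ∈ face (dot v) P →
      toR z ∈ face (dot v) P → Wbtw ℝ (toR x) (toR y) (toR z) → x = y ∨ z = y := by
    intro x y z hx hy hz h
    have := hP.2.2 _ (mem_frontier_of_mem_face hv hy) ⟨y, rfl⟩
    rw [mem_extremePoints_iff_forall_segment] at this
    exact (this.2 _ hx.1 _ hz.1 (mem_segment_iff_wbtw.2 h)).imp (toR_injective ·)
      (toR_injective ·)
  have heq : ∀ {x y : V}, x ∈ face (dot v) P → y ∈ face (dot v) P → dot v y = dot v x :=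
    fun hx hy => le_antisymm (hx.2 _ hy.1) (hy.2 _ hx.1)
  rcases (collinear_of_dot_eq hv (heq hx hy) (heq hx hz)).wbtw_or_wbtw_or_wbtw with h | h | h
  · have := main hx hy hz h
    tauto
  · have := main hy hz hx h
    tauto
  · have := main hz hx hy h
    tauto

theorem IsToricDiagram.sub_eq_or_sub_eq {P : Set V} (hP : IsToricDiagram P) {v : ℤ × ℤ}
    (hv : v ≠ 0) {x x' y y' : ℤ × ℤ} (hxx : x ≠ x') (hyy : y ≠ y')
    (hx : toR x ∈ face (dot v) P) (hx' : toR x' ∈ face (dot v) P)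
    (hy : toR y ∈ face (dot v) P) (hy' : toR y' ∈ face (dot v) P) :
    y' - y = x' - x ∨ y - y' = x' - x := by
  have h1 := hP.eq_or_eq_or_eq hv hx hx' hy
  have h2 := hP.eq_or_eq_or_eq hv hx hx' hy'
  rcases h1 with h1 | rfl | rfl
  · exact absurd h1 hxx
  · rcases h2 with h2 | rfl | rfl
    · exact absurd h2 hxx
    · exact absurd rfl hyy
    · exact Or.inr rfl
  · rcases h2 with h2 | rfl | rfl
    · exact absurd h2 hxx
    · exact Or.inl rfl
    · exact absurd rfl hyy

/-- Every lattice edge of a Minkowski summand of a toric diagram `P = latticeHull Y + latticeHull L`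
is an edge of one of the two given summands. -/
theorem IsToricDiagram.exists_sub_eq {Y L K : Set (ℤ × ℤ)} {Q : Set V} {v : ℤ × ℤ}
    (hP : IsToricDiagram (latticeHull Y + latticeHull L))
    (hYf : Y.Finite) (hY : Y.Nonempty) (hLf : L.Finite) (hL : L.Nonempty) (hv : v ≠ 0)
    (hK : latticeHull Y + latticeHull L = latticeHull K + Q)
    (hQ : ∃ z, toR z ∈ face (dot v) Q) {k k' : ℤ × ℤ} (hk : k ∈ latticeFace v K)
    (hk' : k' ∈ latticeFace v K) (hkk : k ≠ k') :
    (∃ y ∈ latticeFace v Y, ∃ y' ∈ latticeFace v Y, y' - y = k' - k) ∨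
      ∃ y ∈ latticeFace v L, ∃ y' ∈ latticeFace v L, y' - y = k' - k := by
  obtain ⟨z, hz⟩ := hQ
  have hmem : ∀ {a}, a ∈ latticeFace v K →
      toR (a + z) ∈ face (dot v) (latticeHull Y + latticeHull L) := fun ha => by
    rw [hK, face_add, toR_add]
    exact add_mem_add (toR_mem_face ha) hz
  have hYL : ∀ {a b}, a ∈ latticeFace v Y → b ∈ latticeFace v L →
      toR (a + b) ∈ face (dot v) (latticeHull Y + latticeHull L) := fun ha hb => by
    rw [face_add, toR_add]
    exact add_mem_add (toR_mem_face ha) (toR_mem_face hb)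
  have hns : ¬ (latticeFace v Y).Subsingleton ∨ ¬ (latticeFace v L).Subsingleton := by
    by_contra! h
    have h1 := hmem hk
    have h2 := hmem hk'
    rw [face_add] at h1 h2
    obtain ⟨a, ha, b, hb, hab⟩ := h1
    obtain ⟨c, hc, d, hd, hcd⟩ := h2
    rw [subsingleton_face_latticeHull h.1 ha hc, subsingleton_face_latticeHull h.2 hb hd] at hab
    exact hkk (add_right_cancel (toR_injective (hab.symm.trans hcd)))
  have hkz : k + z ≠ k' + z := fun h => hkk (add_right_cancel h)
  have e : k' + z - (k + z) = k' - k := by abel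
  rcases hns with h | h
  · left
    rw [not_subsingleton_iff] at h
    obtain ⟨y, hy, y', hy', hyy⟩ := h
    obtain ⟨l, hl⟩ := latticeFace_nonempty v hLf hL
    have := hP.sub_eq_or_sub_eq hv hkz (fun h => hyy (add_right_cancel h)) (hmem hk) (hmem hk')
      (hYL hy hl) (hYL hy' hl)
    rw [e, add_sub_add_right_eq_sub, add_sub_add_right_eq_sub] at this
    exact this.elim (fun h => ⟨y, hy, y', hy', h⟩) (fun h => ⟨y', hy', y, hy, h⟩)
  · right
    rw [not_subsingleton_iff] at h
    obtain ⟨y, hy, y', hy', hyy⟩ := h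
    obtain ⟨l, hl⟩ := latticeFace_nonempty v hYf hY
    have := hP.sub_eq_or_sub_eq hv hkz (fun h => hyy (add_left_cancel h)) (hmem hk) (hmem hk')
      (hYL hl hy) (hYL hl hy')
    rw [e, add_sub_add_left_eq_sub, add_sub_add_left_eq_sub] at this
    exact this.elim (fun h => ⟨y, hy, y', hy', h⟩) (fun h => ⟨y', hy', y, hy, h⟩)

theorem IsToricDiagram.not_parallel {Y L : Set (ℤ × ℤ)} {v : ℤ × ℤ}
    (hP : IsToricDiagram (latticeHull Y + latticeHull L)) (hv : v ≠ 0) {w w' y y' : ℤ × ℤ}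
    (hw : w ∈ latticeFace v Y) (hw' : w' ∈ latticeFace v Y) (hww : w ≠ w')
    (hy : y ∈ latticeFace v L) (hy' : y' ∈ latticeFace v L) (hyy : y ≠ y') : False := by
  have hYL : ∀ {a b}, a ∈ latticeFace v Y → b ∈ latticeFace v L →
      toR (a + b) ∈ face (dot v) (latticeHull Y + latticeHull L) := fun ha hb => by
    rw [face_add, toR_add]
    exact add_mem_add (toR_mem_face ha) (toR_mem_face hb)
  have h1 := hP.eq_or_eq_or_eq hv (hYL hw hy) (hYL hw' hy) (hYL hw hy')
  have h2 := hP.eq_or_eq_or_eq hv (hYL hw hy) (hYL hw' hy) (hYL hw' hy')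
  simp only [Prod.ext_iff, Prod.fst_add, Prod.snd_add, ne_eq] at *
  omega

/-- The edges of a Minkowski summand of a toric diagram are primitive. -/
theorem IsToricDiagram.not_multiple {Y L : Set (ℤ × ℤ)} {v : ℤ × ℤ}
    (hP : IsToricDiagram (latticeHull Y + latticeHull L)) (hYf : Y.Finite) (hY : Y.Nonempty)
    (hv : v ≠ 0) {y y' m : ℤ × ℤ} (hy : y ∈ latticeFace v L) (hy' : y' ∈ latticeFace v L)
    (hm : m ≠ 0) {k : ℤ} (hk : 2 ≤ k) (h : y' - y = k • m) : False := by
  have hfy := toR_mem_face hy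
  have hfy' := toR_mem_face hy'
  have hk' : (2 : ℝ) ≤ k := by exact_mod_cast hk
  obtain rfl : y' = y + k • m := by rw [← h]; abel
  have hym : toR (y + m) = (1 - 1 / (k : ℝ)) • toR y + (1 / (k : ℝ)) • toR (y + k • m) := by
    refine Prod.ext ?_ ?_ <;>
    · simp [toR]
      field_simp
      ring
  have h0 : 0 ≤ 1 / (k : ℝ) := by positivity
  have h1 : 1 / (k : ℝ) ≤ 1 := by
    rw [div_le_one (by linarith)]
    linarith
  have hmid : toR (y + m) ∈ face (dot v) (latticeHull L) := by
    have e := le_antisymm (hfy.2 _ hfy'.1) (hfy'.2 _ hfy.1)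
    refine ⟨?_, fun z hz => ?_⟩
    · rw [hym]
      exact convex_convexHull ℝ _ hfy.1 hfy'.1 (by linarith) h0 (by ring)
    · refine (hfy.2 z hz).trans (le_of_eq ?_)
      rw [hym, map_add, map_smul, map_smul, e, smul_eq_mul, smul_eq_mul]
      ring
  obtain ⟨w, hw⟩ := latticeFace_nonempty v hYf hY
  have hYL : ∀ {b}, toR b ∈ face (dot v) (latticeHull L) →
      toR (w + b) ∈ face (dot v) (latticeHull Y + latticeHull L) := fun hb => by
    rw [face_add, toR_add]
    exact add_mem_add (toR_mem_face hw) hb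
  have hk1 : k - 1 ≠ 0 := by omega
  have hk0 : k ≠ 0 := by omega
  rcases hP.eq_or_eq_or_eq hv (hYL hfy) (hYL hmid) (hYL hfy') with h | h | h
  · simp [hm] at h
  · simp only [add_right_inj] at h
    exact smul_ne_zero hk1 hm (by rw [sub_smul, one_smul, ← h, sub_self])
  · simp only [add_right_inj, left_eq_add] at h
    exact smul_ne_zero hk0 hm h

/-- The vertices of `GMSW p q`. -/
def gmswVertices (p q : ℤ) : Set (ℤ × ℤ) := {(0, 0), (1, 0), (p, p), (p - q - 1, p - q)}

theorem gmsw_upward_edge {p q : ℤ} (hq : 0 < q) (hpq : q < p) {v y y' : ℤ × ℤ} (hv : 0 < v.1)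
    (hy : y ∈ latticeFace v (gmswVertices p q)) (hy' : y' ∈ latticeFace v (gmswVertices p q))
    (h : y.2 < y'.2) : y' - y = (p - 1, p) := by
  obtain ⟨v1, v2⟩ := v
  obtain ⟨hy, hm⟩ := hy
  obtain ⟨hy', hm'⟩ := hy'
  simp only [gmswVertices, mem_insert_iff, mem_singleton_iff, forall_eq_or_imp, forall_eq] at *
  obtain ⟨a1, a2, a3, a4⟩ := hm
  obtain ⟨b1, b2, b3, b4⟩ := hm'
  rcases hy with rfl | rfl | rfl | rfl <;> rcases hy' with rfl | rfl | rfl | rfl <;>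
    simp only [Prod.mk_sub_mk, Prod.mk.injEq] at * <;> try first | omega | (simp; done)
  · exfalso
    have e : v1 = v1 * (p - q - 1) + v2 * (p - q) := by linarith
    have := mul_pos hv (show 0 < p + q by omega)
    nlinarith [mul_le_mul_of_nonneg_left a3 (show 0 ≤ p - q by omega)]
  · exfalso
    have e : v1 * (q + 1) + v2 * q = 0 := by linarith
    have := mul_pos hv (show 0 < p by omega)
    nlinarith [mul_le_mul_of_nonneg_left a1 hq.le]

theorem gmsw_downward_edge {p q : ℤ} (hq : 0 < q) (hpq : q < p) {v y y' : ℤ × ℤ} (hv : v.1 < 0)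
    (hy : y ∈ latticeFace v (gmswVertices p q)) (hy' : y' ∈ latticeFace v (gmswVertices p q))
    (h : y'.2 < y.2) : y' - y = (-q - 1, -q) ∨ y' - y = (q + 1 - p, q - p) := by
  obtain ⟨v1, v2⟩ := v
  obtain ⟨hy, hm⟩ := hy
  obtain ⟨hy', hm'⟩ := hy'
  simp only [gmswVertices, mem_insert_iff, mem_singleton_iff, forall_eq_or_imp, forall_eq] at *
  obtain ⟨a1, a2, a3, a4⟩ := hm
  obtain ⟨b1, b2, b3, b4⟩ := hm'
  rcases hy with rfl | rfl | rfl | rfl <;> rcases hy' with rfl | rfl | rfl | rfl <;>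
    simp only [Prod.mk_sub_mk, Prod.mk.injEq] at * <;> try omega
  exfalso
  have e : p * (v1 + v2) = 0 := by linarith
  have : v1 + v2 = 0 := (mul_eq_zero.1 e).resolve_left (by omega)
  obtain rfl : v2 = -v1 := by omega
  linarith

theorem gmswVertices_finite (p q : ℤ) : (gmswVertices p q).Finite := by
  simp [gmswVertices]

theorem gmswVertices_nonempty (p q : ℤ) : (gmswVertices p q).Nonempty :=
  ⟨(0, 0), by simp [gmswVertices]⟩

theorem gmsw_eq_one_or_odd_of_triangle {p q : ℤ} (hq : 0 < q) (hpq : q < p) {l l' : ℤ × ℤ}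
    (hP : IsToricDiagram (latticeHull (gmswVertices p q) + latticeHull {l, l'}))
    {K : Set (ℤ × ℤ)} {Q : Set V}
    (hK : latticeHull (gmswVertices p q) + latticeHull {l, l'} = latticeHull K + Q)
    (hQ : ∀ v, ∃ z, toR z ∈ face (dot v) Q) {a b c : ℤ × ℤ} (ha : a ∈ K) (hb : b ∈ K)
    (hc : c ∈ K) (habc : ∀ k ∈ K, k = a ∨ k = b ∨ k = c) (hab : b - a = (1, 0))
    (hac : a.2 < c.2) : q = 1 ∨ Odd (p - q) := by
  have hYf := gmswVertices_finite p q
  have hY := gmswVertices_nonempty p q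
  have hLf : ({l, l'} : Set (ℤ × ℤ)).Finite := by simp
  have hL : ({l, l'} : Set (ℤ × ℤ)).Nonempty := by simp
  obtain ⟨a1, a2⟩ := a
  obtain ⟨b1, b2⟩ := b
  obtain ⟨c1, c2⟩ := c
  simp only [Prod.mk_sub_mk, Prod.mk.injEq] at hab hac
  obtain ⟨rfl, rfl⟩ : b1 = a1 + 1 ∧ b2 = a2 := by omega
  set f : ℤ × ℤ := (c2 - b2, a1 + 1 - c1) with hf
  set g : ℤ × ℤ := (b2 - c2, c1 - a1) with hg
  have hf0 : f ≠ 0 := by simp [hf, Prod.ext_iff]; omega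
  have hg0 : g ≠ 0 := by simp [hg, Prod.ext_iff]; omega
  have hbf : (a1 + 1, b2) ∈ latticeFace f K := by
    refine ⟨hb, fun k hk => ?_⟩
    rcases habc k hk with rfl | rfl | rfl <;> simp only [hf] <;> nlinarith
  have hcf : (c1, c2) ∈ latticeFace f K := by
    refine ⟨hc, fun k hk => ?_⟩
    rcases habc k hk with rfl | rfl | rfl <;> simp only [hf] <;> nlinarith
  have hcg : (c1, c2) ∈ latticeFace g K := by
    refine ⟨hc, fun k hk => ?_⟩
    rcases habc k hk with rfl | rfl | rfl <;> simp only [hg] <;> nlinarith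
  have hag : (a1, b2) ∈ latticeFace g K := by
    refine ⟨ha, fun k hk => ?_⟩
    rcases habc k hk with rfl | rfl | rfl <;> simp only [hg] <;> nlinarith
  have hF := hP.exists_sub_eq hYf hY hLf hL hf0 hK (hQ f) hbf hcf (by simp; omega)
  have hG := hP.exists_sub_eq hYf hY hLf hL hg0 hK (hQ g) hcg hag (by simp; omega)
  rcases hF with ⟨y, hy, y', hy', e⟩ | ⟨y, hy, y', hy', e⟩
  · have h1 := gmsw_upward_edge hq hpq (by simp [hf]; omega) hy hy'
      (by have := congrArg Prod.snd e; simp at this; omega)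
    rw [e] at h1
    simp only [Prod.mk_sub_mk, Prod.mk.injEq] at h1
    rcases hG with ⟨w, hw, w', hw', e'⟩ | ⟨w, hw, w', hw', e'⟩
    · have h2 := gmsw_downward_edge hq hpq (by simp [hg]; omega) hw hw'
        (by have := congrArg Prod.snd e'; simp at this; omega)
      rw [e'] at h2
      simp only [Prod.mk_sub_mk, Prod.mk.injEq] at h2
      omega
    · refine (hP.not_multiple hYf hY hg0 hw hw' (m := (-1, -1)) (k := p) (by simp) (by omega)
        ?_).elim
      rw [e']
      simp only [Prod.mk_sub_mk, Prod.smul_mk, smul_eq_mul, Prod.mk.injEq]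
      omega
  · rcases hG with ⟨w, hw, w', hw', e'⟩ | ⟨w, hw, w', hw', e'⟩
    · have h2 := gmsw_downward_edge hq hpq (by simp [hg]; omega) hw hw'
        (by have := congrArg Prod.snd e'; simp at this; omega)
      rw [e'] at h2
      simp only [Prod.mk_sub_mk, Prod.mk.injEq] at h2
      rcases h2 with h2 | h2
      · left
        by_contra hq1
        refine hP.not_multiple hYf hY hf0 hy hy' (m := (1, 1)) (k := q) (by simp) (by omega) ?_
        rw [e]
        simp only [Prod.mk_sub_mk, Prod.smul_mk, smul_eq_mul, Prod.mk.injEq]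
        omega
      · right
        by_contra hodd
        rw [Int.not_odd_iff_even] at hodd
        obtain ⟨k, hk⟩ := hodd
        refine hP.not_multiple hYf hY hf0 hy hy' (m := (k - 1, k)) (k := 2) ?_ le_rfl ?_
        · simp [Prod.ext_iff]
          omega
        · rw [e]
          simp only [Prod.mk_sub_mk, Prod.smul_mk, smul_eq_mul, Prod.mk.injEq]
          omega
    · exfalso
      obtain ⟨hy, -⟩ := hy
      obtain ⟨hy', -⟩ := hy'
      obtain ⟨hw, -⟩ := hw
      obtain ⟨hw', -⟩ := hw'
      simp only [mem_insert_iff, mem_singleton_iff] at hy hy' hw hw'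
      simp only [Prod.ext_iff, Prod.fst_sub, Prod.snd_sub] at *
      omega

theorem latticeHull_pair (a b : ℤ × ℤ) : latticeHull {a, b} = segment ℝ (toR a) (toR b) := by
  rw [latticeHull, image_pair, convexHull_pair]

theorem latticeHull_triple (a b c : ℤ × ℤ) :
    latticeHull {a, b, c} = convexHull ℝ {toR a, toR b, toR c} := by
  rw [latticeHull, image_insert_eq, image_pair]

theorem GMSW_eq_latticeHull (p q : ℤ) : GMSW p q = latticeHull (gmswVertices p q) := rfl

theorem exists_latticeHull_of_segment_or_triangle {K : Set V}
    (h : IsLatticeSegment K ∨ IsLatticeTriangle K) :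
    ∃ S : Set (ℤ × ℤ), S.Finite ∧ S.Nonempty ∧ K = latticeHull S := by
  rcases h with ⟨a, b, -, rfl⟩ | ⟨a, b, c, -, rfl⟩
  · exact ⟨{a, b}, by simp, by simp, (latticeHull_pair a b).symm⟩
  · exact ⟨{a, b, c}, by simp, by simp, (latticeHull_triple a b c).symm⟩

theorem exists_toR_mem_face_sum {ι : Type*} (s : Finset ι) (K : ι → Set V)
    (h : ∀ i, IsLatticeSegment (K i) ∨ IsLatticeTriangle (K i)) (v : ℤ × ℤ) :
    ∃ z, toR z ∈ face (dot v) (∑ i ∈ s, K i) := by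
  have h1 : ∀ i, ∃ z, toR z ∈ face (dot v) (K i) := fun i => by
    obtain ⟨S, hf, hS, e⟩ := exists_latticeHull_of_segment_or_triangle (h i)
    obtain ⟨z, hz⟩ := latticeFace_nonempty v hf hS
    exact ⟨z, e ▸ toR_mem_face hz⟩
  choose z hz using h1
  refine ⟨∑ i ∈ s, z i, ?_⟩
  rw [toR_sum, face_sum]
  exact Set.finsetSum_mem_finsetSum _ _ _ fun i _ => hz i

theorem gmsw_bottom_mem (p q : ℤ) (hq : 0 < q) (hpq : q < p) :
    (0, 0) ∈ latticeFace (0, -1) (gmswVertices p q) ∧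
      (1, 0) ∈ latticeFace (0, -1) (gmswVertices p q) := by
  constructor <;> refine ⟨by simp [gmswVertices], ?_⟩ <;>
  · rintro t (rfl | rfl | rfl | rfl) <;> simp <;> omega

theorem eq_one_or_odd_of_decomposition {p q : ℤ} (hq : 0 < q) (hpq : q < p) {L : Set V}
    (hL : IsLatticeSegment L) (hP : IsToricDiagram (GMSW p q + L))
    (hD : HasLatticeMaximalDecomposition (GMSW p q + L)) : q = 1 ∨ Odd (p - q) := by
  obtain ⟨l, l', hll, rfl⟩ := hL
  rw [GMSW_eq_latticeHull, ← latticeHull_pair] at hP hD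
  obtain ⟨m, K, -, hPK, hK⟩ := hD
  have hYf := gmswVertices_finite p q
  have hY := gmswVertices_nonempty p q
  have hLf : ({l, l'} : Set (ℤ × ℤ)).Finite := by simp
  have hL : ({l, l'} : Set (ℤ × ℤ)).Nonempty := by simp
  obtain ⟨hA, hB⟩ := gmsw_bottom_mem p q hq hpq
  have hu : ((0, -1) : ℤ × ℤ) ≠ 0 := by simp
  have hu' : ((0, 1) : ℤ × ℤ) ≠ 0 := by simp
  have hhor : ∀ {y y'}, y ∈ ({l, l'} : Set (ℤ × ℤ)) → y' ∈ ({l, l'} : Set (ℤ × ℤ)) →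
      y ≠ y' → y.2 = y'.2 → False := by
    intro y y' hy hy' hne h2
    have hfl : ∀ t ∈ ({l, l'} : Set (ℤ × ℤ)), t.2 = y.2 := by
      rintro t (rfl | rfl) <;> rcases hy with rfl | rfl <;> rcases hy' with rfl | rfl <;>
        simp_all
    refine hP.not_parallel hu hA hB (by simp) ⟨hy, fun t ht => ?_⟩ ⟨hy', fun t ht => ?_⟩ hne
    · simp [hfl t ht]
    · simp [hfl t ht, h2]
  obtain ⟨k, hk⟩ : ∃ k, ¬ (face (dot (0, -1)) (K k)).Subsingleton := by
    by_contra! hsub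
    have h1 := subsingleton_sum Finset.univ (fun k => face (dot (0, -1)) (K k))
      fun k _ => hsub k
    rw [← face_sum, ← hPK, face_add] at h1
    obtain ⟨s, hs⟩ := latticeFace_nonempty (0, -1) hLf hL
    have := h1 (add_mem_add (toR_mem_face hA) (toR_mem_face hs))
      (add_mem_add (toR_mem_face hB) (toR_mem_face hs))
    have := toR_injective (add_right_cancel this)
    simp at this
  rw [← Finset.add_sum_erase _ _ (Finset.mem_univ k)] at hPK
  have hQ := exists_toR_mem_face_sum (Finset.univ.erase k) K hK
  set Q := ∑ i ∈ Finset.univ.erase k, K i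
  have bottom : ∀ {S : Set (ℤ × ℤ)}, K k = latticeHull S →
      ∃ a ∈ latticeFace (0, -1) S, ∃ b ∈ latticeFace (0, -1) S, b - a = (1, 0) := by
    intro S e
    rw [e] at hk hPK
    have : ¬ (latticeFace (0, -1) S).Subsingleton := fun h => hk (subsingleton_face_latticeHull h)
    rw [not_subsingleton_iff] at this
    obtain ⟨a, ha, b, hb, hab⟩ := this
    have hab2 : a.2 = b.2 := by
      have h1 := ha.2 b hb.1
      have h2 := hb.2 a ha.1
      simp at h1 h2
      omega
    rcases hP.exists_sub_eq hYf hY hLf hL hu hPK (hQ _) ha hb hab with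
      ⟨y, hy, y', hy', e⟩ | ⟨y, hy, y', hy', e⟩
    · have h1 := hy.2 _ hA.1
      have h2 := hy'.2 _ hA.1
      obtain ⟨hy, -⟩ := hy
      obtain ⟨hy', -⟩ := hy'
      have : b - a = (1, 0) ∨ a - b = (1, 0) := by
        simp only [gmswVertices, mem_insert_iff, mem_singleton_iff] at hy hy'
        simp only [Prod.ext_iff, Prod.fst_sub, Prod.snd_sub, ne_eq] at *
        omega
      exact this.elim (fun h => ⟨a, ha, b, hb, h⟩) (fun h => ⟨b, hb, a, ha, h⟩)
    · refine (hhor hy.1 hy'.1 ?_ ?_).elim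
      · rintro rfl
        exact hab (sub_eq_zero.1 (by rw [← e, sub_self])).symm
      · have := congrArg Prod.snd e
        simp at this
        omega
  rcases hK k with ⟨a, b, hab, e⟩ | ⟨a, b, c, hind, e⟩
  · exfalso
    rw [← latticeHull_pair] at e
    obtain ⟨x, hx, y, hy, hxy⟩ := bottom e
    have hxy1 : y = x + (1, 0) := by rw [← hxy]; abel
    have hab2 : ∀ t ∈ ({a, b} : Set (ℤ × ℤ)), t.2 = x.2 := by
      obtain ⟨hx, -⟩ := hx
      obtain ⟨hy, -⟩ := hy
      simp only [mem_insert_iff, mem_singleton_iff, Prod.ext_iff, Prod.fst_add, Prod.snd_add] at *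
      omega
    rw [e] at hPK
    rcases hP.exists_sub_eq hYf hY hLf hL hu' hPK (hQ _) (k := x) (k' := y)
      ⟨hx.1, fun t ht => by simp [hab2 t ht]⟩
      ⟨hy.1, fun t ht => by simp [hab2 t ht, hab2 y hy.1]⟩ (by rw [hxy1]; simp) with
      ⟨w, hw, w', hw', e'⟩ | ⟨w, hw, w', hw', e'⟩
    · have hC : (p, p) ∈ gmswVertices p q := by simp [gmswVertices]
      have h1 := hw.2 _ hC
      have h2 := hw'.2 _ hC
      obtain ⟨hw, -⟩ := hw
      obtain ⟨hw', -⟩ := hw'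
      rw [hxy] at e'
      simp only [gmswVertices, mem_insert_iff, mem_singleton_iff] at hw hw'
      simp only [Prod.ext_iff, Prod.fst_sub, Prod.snd_sub] at *
      omega
    · rw [hxy] at e'
      refine hhor hw.1 hw'.1 ?_ ?_
      · rintro rfl
        rw [sub_self] at e'
        simp [Prod.ext_iff] at e'
      · have := congrArg Prod.snd e'
        simp at this
        omega
  · rw [← latticeHull_triple] at e
    obtain ⟨x, hx, y, hy, hxy⟩ := bottom e
    rw [e] at hPK
    have hne : ¬ (b.2 = a.2 ∧ c.2 = a.2) := by
      rintro ⟨h1, h2⟩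
      rw [affineIndependent_iff_not_collinear_set] at hind
      refine hind (collinear_of_dot_eq hu' ?_ ?_) <;> simp [dot_toR, h1, h2]
    have hx2 := hx.2
    have hy2 : y.2 = x.2 := by
      have := congrArg Prod.snd hxy
      simp at this
      omega
    have hy1 : y.1 = x.1 + 1 := by
      have := congrArg Prod.fst hxy
      simp at this
      omega
    have fin := fun z => gmsw_eq_one_or_odd_of_triangle hq hpq hP hPK hQ (c := z) hx.1 hy.1
    simp only [mem_insert_iff, mem_singleton_iff, forall_eq_or_imp, forall_eq] at hx2
    have hxS := hx.1
    have hyS := hy.1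
    simp only [mem_insert_iff, mem_singleton_iff] at hxS hyS
    rcases hxS with rfl | rfl | rfl <;> rcases hyS with rfl | rfl | rfl <;> try omega
    · exact fin c (by simp) (by simp) hxy (by omega)
    · exact fin b (by simp) (by simp) hxy (by omega)
    · exact fin c (by simp) (by simp) hxy (by omega)
    · exact fin a (by simp) (by simp) hxy (by omega)
    · exact fin b (by simp) (by simp) hxy (by omega)
    · exact fin a (by simp) (by simp) hxy (by omega)

/-- The cross product of `b - a` and `x - a`; nonnegative when `x` is to the left of `a → b`. -/
def side (a b : ℤ × ℤ) (x : V) : ℝ :=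
  ((b.1 : ℝ) - a.1) * (x.2 - a.2) - ((b.2 : ℝ) - a.2) * (x.1 - a.1)

theorem side_toR (a b c : ℤ × ℤ) : side a b (toR c) = (crossZ (b - a) (c - a) : ℤ) := by
  simp [side, toR, crossZ]

theorem side_combination (a b : ℤ × ℤ) (x y : V) {s t : ℝ} (h : s + t = 1) :
    side a b (s • x + t • y) = s * side a b x + t * side a b y := by
  obtain rfl : s = 1 - t := by linarith
  simp [side]
  ring

theorem continuous_side (a b : ℤ × ℤ) : Continuous (side a b) := by
  unfold side
  fun_prop

theorem convex_setOf_side_nonneg (a b : ℤ × ℤ) : Convex ℝ {x | 0 ≤ side a b x} := by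
  intro x hx y hy s t hs ht hst
  simp only [mem_ofPred_eq] at *
  rw [side_combination _ _ _ _ hst]
  positivity

theorem mem_latticeHull_of_side_nonneg {S : Set (ℤ × ℤ)} {a b c : ℤ × ℤ} (ha : a ∈ S)
    (hb : b ∈ S) (hc : c ∈ S) (h : 0 < crossZ (b - a) (c - a)) {x : V} (hab : 0 ≤ side a b x)
    (hbc : 0 ≤ side b c x) (hca : 0 ≤ side c a x) : x ∈ latticeHull S := by
  obtain ⟨D, hD⟩ : ∃ D : ℝ, D = (crossZ (b - a) (c - a) : ℤ) := ⟨_, rfl⟩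
  have hD0 : 0 < D := by rw [hD]; exact_mod_cast h
  have hsum : side b c x / D + side c a x / D + side a b x / D = 1 := by
    rw [← add_div, ← add_div, div_eq_one_iff_eq hD0.ne', hD]
    simp [side, crossZ]
    ring
  have hx : x = (side b c x / D) • toR a + (side c a x / D) • toR b + (side a b x / D) • toR c := by
    refine Prod.ext ?_ ?_ <;>
    · simp only [toR, Prod.fst_add, Prod.snd_add, Prod.smul_fst, Prod.smul_snd, smul_eq_mul]
      field_simp
      rw [hD]
      simp [side, crossZ]
      ring
  have hsub : ∀ {z}, z ∈ S → toR z ∈ latticeHull S := fun hz =>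
    subset_convexHull ℝ _ (mem_image_of_mem _ hz)
  rw [hx]
  have := (convex_convexHull ℝ (toR '' S)).sum_mem (t := Finset.univ)
    (w := ![side b c x / D, side c a x / D, side a b x / D]) (z := ![toR a, toR b, toR c])
    (by intro i _; fin_cases i <;> simp <;> positivity) (by simpa [Fin.sum_univ_three] using hsum)
    (by intro i _; fin_cases i <;> simp <;> apply hsub <;> assumption)
  simpa [Fin.sum_univ_three, latticeHull] using this

/-- Consecutive vertices of a lattice hexagon, listed counterclockwise, with primitive edges. -/
structure IsPrimitiveHexagon (h : Fin 6 → ℤ × ℤ) : Prop where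
  nonneg : ∀ i j, 0 ≤ crossZ (h (i + 1) - h i) (h j - h i)
  pos : ∀ i j, j ≠ i → j ≠ i + 1 → 0 < crossZ (h (i + 1) - h i) (h j - h i)
  coprime : ∀ i, IsCoprime (h (i + 1) - h i).1 (h (i + 1) - h i).2

namespace IsPrimitiveHexagon

variable {h : Fin 6 → ℤ × ℤ} {S : Set (ℤ × ℤ)}

theorem latticeHull_eq (hh : IsPrimitiveHexagon h) (hS : ∀ i, h i ∈ S)
    (hS' : ∀ i, ∀ s ∈ S, 0 ≤ crossZ (h (i + 1) - h i) (s - h i)) :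
    latticeHull S = {x | ∀ i, 0 ≤ side (h i) (h (i + 1)) x} := by
  apply Subset.antisymm
  · intro x hx i
    refine convexHull_min ?_ (convex_setOf_side_nonneg (h i) (h (i + 1))) hx
    rintro _ ⟨s, hs, rfl⟩
    rw [mem_ofPred_eq, side_toR]
    exact_mod_cast hS' i s hs
  · intro x hx
    have swap : ∀ a b, side b a x = - side a b x := fun a b => by simp only [side]; ring
    have tri : ∀ j, j ≠ 0 → j + 1 ≠ 0 → 0 ≤ side (h 0) (h j) x → 0 ≤ side (h (j + 1)) (h 0) x →
        x ∈ latticeHull S := fun j h0 h1 hl hr => by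
      refine mem_latticeHull_of_side_nonneg (hS 0) (hS j) (hS (j + 1)) ?_ hl (hx j) hr
      convert hh.pos j 0 h0.symm h1.symm using 1
      simp only [crossZ, Prod.fst_sub, Prod.snd_sub]
      ring
    by_contra hn
    have h1 := hx 0
    have step : ∀ j, j ≠ 0 → j + 1 ≠ 0 → 0 ≤ side (h 0) (h j) x →
        0 ≤ side (h 0) (h (j + 1)) x := fun j h0 h1 hl => by
      by_contra hc
      refine hn (tri j h0 h1 hl ?_)
      rw [swap]
      linarith
    have h2 := step 1 (by decide) (by decide) h1
    have h3 := step 2 (by decide) (by decide) h2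
    have h4 := step 3 (by decide) (by decide) h3
    exact hn (tri 4 (by decide) (by decide) h4 (hx 5))

theorem eq_vertex (hh : IsPrimitiveHexagon h) {z : ℤ × ℤ}
    (hz : ∀ i, 0 ≤ crossZ (h (i + 1) - h i) (z - h i)) {i : Fin 6}
    (hi : crossZ (h (i + 1) - h i) (z - h i) = 0) : z = h i ∨ z = h (i + 1) := by
  obtain ⟨t, ht⟩ : ∃ t : ℤ, z = h i + t • (h (i + 1) - h i) := by
    obtain ⟨u, v, huv⟩ := hh.coprime i
    simp only [crossZ] at hi
    refine ⟨u * (z - h i).1 + v * (z - h i).2, ?_⟩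
    rw [← sub_eq_iff_eq_add']
    refine Prod.ext ?_ ?_ <;> simp only [Prod.smul_fst, Prod.smul_snd, smul_eq_mul]
    · linear_combination (-(z - h i).1) * huv - v * hi
    · linear_combination (-(z - h i).2) * huv + u * hi
  have hne : ∀ i : Fin 6,
      i ≠ i + 1 + 1 ∧ i + 5 ≠ i + 1 ∧ i + 1 ≠ i + 5 + 1 ∧ i + 5 + 1 = i := by
    decide
  have h1 : t ≤ 1 := by
    have h2 := hz (i + 1)
    have h3 := hh.pos (i + 1) i (by simp) (hne i).1
    rw [show crossZ (h (i + 1 + 1) - h (i + 1)) (z - h (i + 1)) =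
      (1 - t) * crossZ (h (i + 1 + 1) - h (i + 1)) (h i - h (i + 1)) by
        rw [ht]; simp [crossZ]; ring] at h2
    nlinarith
  have h0 : 0 ≤ t := by
    have h2 := hz (i + 5)
    have h3 := hh.pos (i + 5) (i + 1) (hne i).2.1.symm (hne i).2.2.1
    rw [(hne i).2.2.2] at h2 h3
    rw [show crossZ (h i - h (i + 5)) (z - h (i + 5)) =
      t * crossZ (h i - h (i + 5)) (h (i + 1) - h (i + 5)) by
        rw [ht]; simp [crossZ]; ring] at h2
    nlinarith
  obtain rfl | rfl : t = 0 ∨ t = 1 := by omega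
  · left
    simp [ht]
  · right
    simp [ht]

theorem mem_extremePoints (hh : IsPrimitiveHexagon h) (i : Fin 6) :
    toR (h i) ∈ {x | ∀ i, 0 ≤ side (h i) (h (i + 1)) x}.extremePoints ℝ := by
  refine ⟨fun j => ?_, ?_⟩
  · rw [side_toR]
    exact_mod_cast hh.nonneg j i
  intro x hx y hy hxy
  obtain ⟨s, t, hs, ht, hst, e⟩ := hxy
  have zero : ∀ j, side (h j) (h (j + 1)) (toR (h i)) = 0 → side (h j) (h (j + 1)) x = 0 := by
    intro j hj
    rw [← e, side_combination _ _ _ _ hst] at hj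
    have h1 := mul_nonneg hs.le (hx j)
    have h2 := mul_nonneg ht.le (hy j)
    exact (mul_eq_zero.1 (by linarith : s * side (h j) (h (j + 1)) x = 0)).resolve_left hs.ne'
  have hne : ∀ i : Fin 6, i + 1 ≠ i + 5 ∧ i + 5 + 1 = i := by decide
  have e' := (hne i).2
  have z1 := zero i (by simp [side, toR])
  have z2 := zero (i + 5) (by simp [e', side, toR]; ring)
  have hp := hh.pos (i + 5) (i + 1) (hne i).1 (by rw [e']; simp)
  rw [e'] at z2 hp
  have hp' : (crossZ (h i - h (i + 5)) (h (i + 1) - h (i + 5)) : ℝ) ≠ 0 := by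
    exact_mod_cast hp.ne'
  simp only [side, crossZ, Prod.fst_sub, Prod.snd_sub] at z1 z2 hp'
  push_cast at hp'
  refine Prod.ext (mul_left_cancel₀ hp' ?_) (mul_left_cancel₀ hp' ?_) <;> simp only [toR]
  · linear_combination (((h (i + 1)).1 : ℝ) - (h i).1) * z2 - (((h i).1 : ℝ) - (h (i + 5)).1) * z1
  · linear_combination (((h (i + 1)).2 : ℝ) - (h i).2) * z2 - (((h i).2 : ℝ) - (h (i + 5)).2) * z1

theorem isToricDiagram (hh : IsPrimitiveHexagon h) (hf : S.Finite) (hS : ∀ i, h i ∈ S)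
    (hS' : ∀ i, ∀ s ∈ S, 0 ≤ crossZ (h (i + 1) - h i) (s - h i)) :
    IsToricDiagram (latticeHull S) := by
  have hopen : IsOpen {x | ∀ i, 0 < side (h i) (h (i + 1)) x} := by
    rw [ofPred_forall]
    exact isOpen_iInter_of_finite fun i =>
      isOpen_lt continuous_const (continuous_side (h i) (h (i + 1)))
  have hclosed : IsClosed {x | ∀ i, 0 ≤ side (h i) (h (i + 1)) x} := by
    rw [ofPred_forall]
    exact isClosed_iInter fun i =>
      isClosed_le continuous_const (continuous_side (h i) (h (i + 1)))
  have hint : {x | ∀ i, 0 < side (h i) (h (i + 1)) x} ⊆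
      interior {x | ∀ i, 0 ≤ side (h i) (h (i + 1)) x} :=
    interior_maximal (fun x hx i => (hx i).le) hopen
  refine ⟨⟨hf.toFinset, ?_, by rw [hf.coe_toFinset]; rfl⟩, ?_, ?_⟩
  · simpa using ⟨h 0, hS 0⟩
  all_goals rw [hh.latticeHull_eq hS hS']
  · refine ⟨_, hint (a := (1 / 3 : ℝ) • toR (h 0) + (2 / 3 : ℝ) •
      ((1 / 2 : ℝ) • toR (h 2) + (1 / 2 : ℝ) • toR (h 4))) fun i => ?_⟩
    rw [side_combination _ _ _ _ (by norm_num), side_combination _ _ _ _ (by norm_num), side_toR,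
      side_toR, side_toR]
    have nonneg : ∀ j, (0 : ℝ) ≤ (crossZ (h (i + 1) - h i) (h j - h i) : ℤ) := fun j => by
      exact_mod_cast hh.nonneg i j
    have exists_other : ∀ i : Fin 6, ∃ j : Fin 6, (j = 0 ∨ j = 2 ∨ j = 4) ∧ j ≠ i ∧ j ≠ i + 1 := by
      decide
    obtain ⟨j, hj, hj1, hj2⟩ := exists_other i
    have pos : (0 : ℝ) < (crossZ (h (i + 1) - h i) (h j - h i) : ℤ) := by
      exact_mod_cast hh.pos i j hj1 hj2
    have n0 := nonneg 0
    have n2 := nonneg 2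
    have n4 := nonneg 4
    rcases hj with rfl | rfl | rfl <;> linarith
  · rintro _ hx ⟨z, rfl⟩
    have hz : ∀ i, 0 ≤ side (h i) (h (i + 1)) (toR z) := hclosed.frontier_subset hx
    have hi : ∃ i, side (h i) (h (i + 1)) (toR z) = 0 := by
      by_contra! hne
      exact hx.2 (hint fun i => (hz i).lt_of_ne' (hne i))
    obtain ⟨i, hi⟩ := hi
    simp only [side_toR] at hz hi
    rcases hh.eq_vertex (fun i => by exact_mod_cast hz i) (by exact_mod_cast hi) with e | e <;>
    · rw [e]
      exact hh.mem_extremePoints _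

end IsPrimitiveHexagon

theorem affineIndependent_toR {a b c : ℤ × ℤ} (h : crossZ (b - a) (c - a) ≠ 0) :
    AffineIndependent ℝ ![toR a, toR b, toR c] := by
  rw [affineIndependent_iff_not_collinear_set, collinear_iff_of_mem (p₀ := toR a) (by simp)]
  rintro ⟨v, hv⟩
  obtain ⟨s, hs⟩ := hv (toR b) (by simp)
  obtain ⟨t, ht⟩ := hv (toR c) (by simp)
  simp only [toR, vadd_eq_add, Prod.ext_iff, Prod.fst_add, Prod.snd_add, Prod.smul_fst,
    Prod.smul_snd, smul_eq_mul] at hs ht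
  refine h ((Int.cast_eq_zero (α := ℝ)).1 ?_)
  simp [crossZ, hs, ht]
  ring

/-- A primitive hexagon written both as `latticeHull Y` plus a segment and as a sum of two
triangles provides a toric diagram with a lattice maximal decomposition. -/
theorem IsPrimitiveHexagon.exists_segment {h : Fin 6 → ℤ × ℤ} (hh : IsPrimitiveHexagon h)
    {Y : Set (ℤ × ℤ)} {m a b c a' b' c' : ℤ × ℤ} (hYf : Y.Finite) (hm : (0, 0) ≠ m)
    (hT : crossZ (b - a) (c - a) ≠ 0) (hT' : crossZ (b' - a') (c' - a') ≠ 0)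
    (hY : ∀ i, h i ∈ Y + {(0, 0), m})
    (hY' : ∀ i, ∀ s ∈ Y + {(0, 0), m}, 0 ≤ crossZ (h (i + 1) - h i) (s - h i))
    (hTT : ∀ i, h i ∈ ({a, b, c} + {a', b', c'} : Set (ℤ × ℤ)))
    (hTT' : ∀ i, ∀ s ∈ ({a, b, c} + {a', b', c'} : Set (ℤ × ℤ)),
      0 ≤ crossZ (h (i + 1) - h i) (s - h i)) :
    ∃ L : Set V, IsLatticeSegment L ∧ IsToricDiagram (latticeHull Y + L) ∧
      HasLatticeMaximalDecomposition (latticeHull Y + L) := by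
  refine ⟨latticeHull {(0, 0), m}, ⟨_, _, hm, latticeHull_pair _ _⟩, ?_, ?_⟩
  · rw [← latticeHull_add]
    exact hh.isToricDiagram (hYf.add (by simp)) hY hY'
  · refine ⟨1, ![latticeHull {a, b, c}, latticeHull {a', b', c'}], le_rfl, ?_, fun k => Or.inr ?_⟩
    · rw [Fin.sum_univ_two, ← latticeHull_add, hh.latticeHull_eq hY hY']
      exact (hh.latticeHull_eq hTT hTT').symm.trans (latticeHull_add _ _)
    · fin_cases k
      · exact ⟨a, b, c, affineIndependent_toR hT, latticeHull_triple _ _ _⟩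
      · exact ⟨a', b', c', affineIndependent_toR hT', latticeHull_triple _ _ _⟩

theorem exists_segment_of_eq_one {p : ℤ} (hp : 1 < p) :
    ∃ L : Set V, IsLatticeSegment L ∧ IsToricDiagram (GMSW p 1 + L) ∧
      HasLatticeMaximalDecomposition (GMSW p 1 + L) := by
  have hh : IsPrimitiveHexagon
      ![(0, 0), (1, 0), (2, 1), (p + 1, p + 1), (p - 1, p), (p - 2, p - 1)] := by
    refine ⟨?_, ?_, fun i => ⟨![1, 1, -1, 0, -1, 1] i, ![0, 0, 1, -1, 0, -1] i, ?_⟩⟩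
    · intro i j
      fin_cases i <;> fin_cases j <;> simp [crossZ] <;> nlinarith
    · intro i j
      fin_cases i <;> fin_cases j <;> simp [crossZ] <;> nlinarith
    · fin_cases i <;> simp
      ring
  refine hh.exists_segment (Y := gmswVertices p 1) (m := (1, 1)) (a := (0, 0)) (b := (1, 0))
    (c := (2, 1)) (a' := (0, 0)) (b' := (p - 1, p)) (c' := (p - 2, p - 1))
    (gmswVertices_finite p 1) (by simp) (by simp [crossZ]) ?_ ?_ ?_ ?_ ?_
  · simp [crossZ]
    nlinarith
  · intro i
    rw [mem_add]
    refine ⟨![(0, 0), (1, 0), (1, 0), (p, p), (p - 2, p - 1), (p - 2, p - 1)] i, ?_,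
      ![(0, 0), (0, 0), (1, 1), (1, 1), (1, 1), (0, 0)] i, ?_, ?_⟩ <;>
    · fin_cases i <;> simp [gmswVertices] <;> ring_nf <;> simp
  · rintro i _ ⟨y, hy, z, hz, rfl⟩
    simp only [gmswVertices, mem_insert_iff, mem_singleton_iff] at hy hz
    rcases hy with rfl | rfl | rfl | rfl <;> rcases hz with rfl | rfl <;> fin_cases i <;>
      simp [crossZ] <;> nlinarith
  · intro i
    rw [mem_add]
    refine ⟨![(0, 0), (1, 0), (2, 1), (2, 1), (0, 0), (0, 0)] i, ?_,
      ![(0, 0), (0, 0), (0, 0), (p - 1, p), (p - 1, p), (p - 2, p - 1)] i, ?_, ?_⟩ <;>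
    · fin_cases i <;> simp <;> ring_nf <;> simp
  · rintro i _ ⟨y, hy, z, hz, rfl⟩
    simp only [mem_insert_iff, mem_singleton_iff] at hy hz
    rcases hy with rfl | rfl | rfl <;> rcases hz with rfl | rfl | rfl <;> fin_cases i <;>
      simp [crossZ] <;> nlinarith

theorem exists_segment_of_odd {a k : ℤ} (ha : 0 ≤ a) (hk : 0 ≤ k) :
    ∃ L : Set V, IsLatticeSegment L ∧ IsToricDiagram (GMSW (a + 2 * k + 2) (a + 1) + L) ∧
      HasLatticeMaximalDecomposition (GMSW (a + 2 * k + 2) (a + 1) + L) := by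
  have hak := mul_nonneg ha hk
  have hkk := mul_nonneg hk hk
  have hh : IsPrimitiveHexagon
      ![(0, 0), (1, 0), (a + 2 * k + 2, a + 2 * k + 2), (a + 4 * k + 1, a + 4 * k + 3),
        (4 * k - 1, 4 * k + 2), (2 * k - 1, 2 * k + 1)] := by
    refine ⟨?_, ?_, fun i => ⟨![1, -1, k, -1, 1, -k] i, ![0, 1, 1 - k, 1, -1, k - 1] i, ?_⟩⟩
    · intro i j
      fin_cases i <;> fin_cases j <;> simp [crossZ] <;> nlinarith
    · intro i j
      fin_cases i <;> fin_cases j <;> simp [crossZ] <;> nlinarith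
    · fin_cases i <;> simp <;> ring
  refine hh.exists_segment (Y := gmswVertices (a + 2 * k + 2) (a + 1)) (m := (2 * k - 1, 2 * k + 1))
    (a := (0, 0)) (b := (1, 0)) (c := (2 * k, 2 * k + 1)) (a' := (0, 0))
    (b' := (a + 2 * k + 1, a + 2 * k + 2)) (c' := (2 * k - 1, 2 * k + 1))
    (gmswVertices_finite _ _) ?_ ?_ ?_ ?_ ?_ ?_ ?_
  · simp
    omega
  · simp [crossZ]
    omega
  · simp [crossZ]
    nlinarith
  · intro i
    rw [mem_add]
    refine ⟨![(0, 0), (1, 0), (a + 2 * k + 2, a + 2 * k + 2), (a + 2 * k + 2, a + 2 * k + 2),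
      (2 * k, 2 * k + 1), (0, 0)] i, ?_, ![(0, 0), (0, 0), (0, 0), (2 * k - 1, 2 * k + 1),
      (2 * k - 1, 2 * k + 1), (2 * k - 1, 2 * k + 1)] i, ?_, ?_⟩ <;>
    · fin_cases i <;> simp [gmswVertices] <;> ring_nf <;> simp
  · rintro i _ ⟨y, hy, z, hz, rfl⟩
    simp only [gmswVertices, mem_insert_iff, mem_singleton_iff] at hy hz
    rcases hy with rfl | rfl | rfl | rfl <;> rcases hz with rfl | rfl <;> fin_cases i <;>
      simp [crossZ] <;> nlinarith
  · intro i
    rw [mem_add]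
    refine ⟨![(0, 0), (1, 0), (1, 0), (2 * k, 2 * k + 1), (2 * k, 2 * k + 1), (0, 0)] i, ?_,
      ![(0, 0), (0, 0), (a + 2 * k + 1, a + 2 * k + 2), (a + 2 * k + 1, a + 2 * k + 2),
        (2 * k - 1, 2 * k + 1), (2 * k - 1, 2 * k + 1)] i, ?_, ?_⟩ <;>
    · fin_cases i <;> simp <;> ring_nf <;> simp
  · rintro i _ ⟨y, hy, z, hz, rfl⟩
    simp only [mem_insert_iff, mem_singleton_iff] at hy hz
    rcases hy with rfl | rfl | rfl <;> rcases hz with rfl | rfl | rfl <;> fin_cases i <;>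
      simp [crossZ] <;> nlinarith

/-- For integers `p > q > 0`, there is a lattice segment `L` such that
`𝒴^{p,q} + L` is a toric diagram with a lattice maximal Minkowski decomposition iff
`q = 1` or `p − q` is odd. -/
theorem statement11 (p q : ℤ) (hq : 0 < q) (hpq : q < p) :
    (∃ L : Set V, IsLatticeSegment L ∧ IsToricDiagram (GMSW p q + L) ∧
        HasLatticeMaximalDecomposition (GMSW p q + L)) ↔
      q = 1 ∨ Odd (p - q) := by
  refine ⟨fun ⟨L, hL, hP, hD⟩ => eq_one_or_odd_of_decomposition hq hpq hL hP hD, ?_⟩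
  rintro (rfl | ⟨k, hk⟩)
  · exact exists_segment_of_eq_one hpq
  · obtain ⟨a, rfl⟩ : ∃ a, q = a + 1 := ⟨q - 1, by ring⟩
    obtain rfl : p = a + 2 * k + 2 := by omega
    exact exists_segment_of_odd (by omega) (by omega)
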